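/- arXiv:2409.19360 — 2 statements merged into one kernel-verified Lean document; each statement's English description precedes it below -/
import Mathlib

section
/- If a finite pattern Q contains a subpattern P with no excess and with the same filling closure, then the excess of Q equals its visible excess (Q has no phantom excess). -/
open scoped symmDiff

/-- The left translate `gS` of a finite shape `S` in a group `G`. -/
def gset {G : Type*} [Group G] (g : G) (S : Finset G) : Set G :=
  (fun s => g * s) '' (S : Set G)

/-- A `(C,S)`-filling move: `P ⊊ Q`, some translate `gS` meets `P` in exactly
`|S| - 1` elements, and `Q = P ∪ gC`. -/
def FillMove {G : Type*} [Group G] (C S : Finset G) (P Q : Set G) : Prop :=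
  P ⊂ Q ∧ ∃ g : G, (P ∩ gset g S).ncard = S.card - 1 ∧ Q = P ∪ gset g C

/-- The `(C,S)`-filling closure: the union of all sets reachable from `P` by
finitely many filling moves. -/
def fillClosure {G : Type*} [Group G] (C S : Finset G) (P : Set G) : Set G :=
  {x | ∃ Q : Set G, Relation.ReflTransGen (FillMove C S) P Q ∧ x ∈ Q}


/-- The rank of a finite pattern: the least cardinality of a finite set with the
same filling closure. -/
noncomputable def rank {G : Type*} [Group G] (C S : Finset G) (P : Finset G) : ℕ :=
  sInf {n : ℕ | ∃ R : Finset G, R.card = n ∧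
    fillClosure C S (R : Set G) = fillClosure C S (P : Set G)}

/-- The excess of a finite pattern. -/
noncomputable def excess {G : Type*} [Group G] (C S : Finset G) (P : Finset G) : ℕ :=
  P.card - rank C S P

/-- `Q` is an excess set of the finite pattern `P` if removing it does not change
the filling closure. -/
def ExcessSet {G : Type*} [Group G] (C S : Finset G) (P Q : Finset G) : Prop :=
  Q ⊆ P ∧ fillClosure C S ((P : Set G) \ (Q : Set G)) = fillClosure C S (P : Set G)

/-- The visible excess of a pattern: the maximal cardinality of an excess set. -/
noncomputable def visibleExcess {G : Type*} [Group G] (C S : Finset G) (P : Finset G) : ℕ :=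
  sSup {n : ℕ | ∃ Q : Finset G, ExcessSet C S P Q ∧ Q.card = n}

/-- The rank is at most the size of any finite set with the same filling closure. -/
theorem rank_le_card_of_fillClosure_eq {G : Type*} [Group G] {C S P R : Finset G}
    (h : fillClosure C S (R : Set G) = fillClosure C S (P : Set G)) :
    rank C S P ≤ R.card :=
  Nat.sInf_le ⟨R, rfl, h⟩

/-- The rank depends only on the filling closure. -/
theorem rank_congr {G : Type*} [Group G] {C S P Q : Finset G}
    (h : fillClosure C S (P : Set G) = fillClosure C S (Q : Set G)) :
    rank C S P = rank C S Q := by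
  simp only [rank, h]

/-- An excess set has at most as many elements as the excess. -/
theorem ExcessSet.card_le_excess {G : Type*} [Group G] {C S Q R : Finset G}
    (h : ExcessSet C S Q R) : R.card ≤ excess C S Q := by
  classical
  obtain ⟨hRQ, hR⟩ := h
  rw [← Finset.coe_sdiff] at hR
  have hle := rank_le_card_of_fillClosure_eq hR
  have hcard := Finset.card_sdiff_add_card_eq_card hRQ
  unfold excess
  omega

/-- If a pattern contains a subpattern with no excess and the same filling
closure, then its excess equals its visible excess (no phantom excess). -/
theorem no_phantom_excess {G : Type*} [Group G] (C S : Finset G) (hCS : C ⊆ S)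
    (hfin : ∀ P : Finset G, (fillClosure C S (P : Set G)).Finite)
    (P Q : Finset G) (hPQ : P ⊆ Q) (hP : excess C S P = 0)
    (hfill : fillClosure C S (P : Set G) = fillClosure C S (Q : Set G)) :
    excess C S Q = visibleExcess C S Q := by
  classical
  have hmem : ExcessSet C S Q (Q \ P) := by
    refine ⟨Finset.sdiff_subset, ?_⟩
    rw [← Finset.coe_sdiff, Finset.sdiff_sdiff_eq_self hPQ, hfill]
  have hcard : (Q \ P).card = excess C S Q := by
    refine le_antisymm hmem.card_le_excess ?_
    have hsum := Finset.card_sdiff_add_card_eq_card hPQ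
    have hrank := rank_congr hfill
    unfold excess at hP ⊢
    omega
  refine Eq.symm (IsGreatest.csSup_eq ⟨⟨Q \ P, hmem, hcard⟩, ?_⟩)
  rintro n ⟨R, hR, rfl⟩
  exact hR.card_le_excess
end

section
/- For the triangle shape on ℤ², the filling closure of any finite pattern P is a finite disjoint union of translated triangles v_i + T_{k_i} (1 ≤ i ≤ r) whose neighborhoods are pairwise disjoint, with Σ k_i ≤ |P|. -/
open scoped symmDiff

/-- The triangle shape `T = {(0,0),(1,0),(0,1)}` in `ℤ²`. -/
def TriShape : Set (ℤ × ℤ) := {(0,0), (1,0), (0,1)}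

/-- The translate `v + A` of a set `A ⊆ ℤ²`. -/
def tr (v : ℤ × ℤ) (A : Set (ℤ × ℤ)) : Set (ℤ × ℤ) := (fun p => v + p) '' A

/-- A triangle solitaire move: for some `v`, both `P` and `Q` meet `v + T` in
exactly 2 elements and `P △ Q` is a 2-element subset of `v + T`. -/
def TriMove (P Q : Set (ℤ × ℤ)) : Prop :=
  ∃ v : ℤ × ℤ, (P ∩ tr v TriShape).ncard = 2 ∧ (Q ∩ tr v TriShape).ncard = 2 ∧
    (P ∆ Q) ⊆ tr v TriShape ∧ (P ∆ Q).ncard = 2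

/-- The triangle `T_n = {(a,b) : a,b ≥ 0, a + b ≤ n - 1}`. -/
def TnSet (n : ℕ) : Set (ℤ × ℤ) :=
  {p | 0 ≤ p.1 ∧ 0 ≤ p.2 ∧ p.1 + p.2 < (n : ℤ)}

/-- The horizontal edge `{0,…,n-1} × {0}` of `T_n`. -/
def horizEdge (n : ℕ) : Set (ℤ × ℤ) := {p | 0 ≤ p.1 ∧ p.1 < (n : ℤ) ∧ p.2 = 0}

/-- The vertical edge `{0} × {0,…,n-1}` of `T_n`. -/
def vertEdge (n : ℕ) : Set (ℤ × ℤ) := {p | p.1 = 0 ∧ 0 ≤ p.2 ∧ p.2 < (n : ℤ)}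

/-- The diagonal edge `{(i, n-1-i) : 0 ≤ i ≤ n-1}` of `T_n`. -/
def diagEdge (n : ℕ) : Set (ℤ × ℤ) :=
  {p | 0 ≤ p.1 ∧ 0 ≤ p.2 ∧ p.1 + p.2 = (n : ℤ) - 1}


/-- A triangle filling move: some translate `v + T` meets `P` in exactly 2
elements, and the third element is added. -/
def TriFillMove (P Q : Set (ℤ × ℤ)) : Prop :=
  P ⊂ Q ∧ ∃ v : ℤ × ℤ, (P ∩ tr v TriShape).ncard = 2 ∧ Q = P ∪ tr v TriShape

/-- The triangle filling closure. -/
def triFillClosure (P : Set (ℤ × ℤ)) : Set (ℤ × ℤ) :=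
  {x | ∃ Q : Set (ℤ × ℤ), Relation.ReflTransGen TriFillMove P Q ∧ x ∈ Q}

/-- The six neighbors of a point in the triangular lattice. -/
def nbhd (p : ℤ × ℤ) : Set (ℤ × ℤ) :=
  {p + (1,0), p + (-1,0), p + (0,1), p + (0,-1), p + (1,-1), p + (-1,1)}

/-- A set that contains the third point of a translate of `TriShape` whenever it contains two. -/
def FillClosed (C : Set (ℤ × ℤ)) : Prop :=
  ∀ x y : ℤ, ((x, y) ∈ C → (x + 1, y) ∈ C → (x, y + 1) ∈ C) ∧
    ((x, y) ∈ C → (x, y + 1) ∈ C → (x + 1, y) ∈ C) ∧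
    ((x + 1, y) ∈ C → (x, y + 1) ∈ C → (x, y) ∈ C)

theorem tr_triShape (x y : ℤ) : tr (x, y) TriShape = {(x, y), (x + 1, y), (x, y + 1)} := by
  simp [tr, TriShape, Set.image_insert_eq]

theorem ncard_tr_triShape (v : ℤ × ℤ) : (tr v TriShape).ncard = 3 := by
  obtain ⟨x, y⟩ := v
  rw [tr_triShape, Set.ncard_eq_three]
  exact ⟨_, _, _, by simp, by simp, by simp, rfl⟩

theorem finite_tr_triShape (v : ℤ × ℤ) : (tr v TriShape).Finite :=
  Set.finite_of_ncard_ne_zero (by simp [ncard_tr_triShape])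

theorem ncard_inter_tr_triShape_eq_two {R : Set (ℤ × ℤ)} {v : ℤ × ℤ}
    (h : 2 ≤ (R ∩ tr v TriShape).ncard) (hs : ¬ tr v TriShape ⊆ R) :
    (R ∩ tr v TriShape).ncard = 2 := by
  have hss : R ∩ tr v TriShape ⊂ tr v TriShape := by
    rw [Set.ssubset_iff_subset_ne]
    exact ⟨Set.inter_subset_right, fun he => hs (Set.inter_eq_right.mp he)⟩
  have := Set.ncard_lt_ncard hss (finite_tr_triShape v)
  rw [ncard_tr_triShape] at this
  omega

theorem reflTransGen_union_of_two_le {R : Set (ℤ × ℤ)} {v : ℤ × ℤ}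
    (h : 2 ≤ (R ∩ tr v TriShape).ncard) :
    Relation.ReflTransGen TriFillMove R (R ∪ tr v TriShape) := by
  by_cases hs : tr v TriShape ⊆ R
  · rw [Set.union_eq_self_of_subset_right hs]
  · refine .single ⟨?_, v, ncard_inter_tr_triShape_eq_two h hs, rfl⟩
    rw [Set.ssubset_iff_subset_ne]
    exact ⟨Set.subset_union_left, fun he => hs (he ▸ Set.subset_union_right)⟩

theorem subset_of_reflTransGen_triFillMove {P Q : Set (ℤ × ℤ)}
    (h : Relation.ReflTransGen TriFillMove P Q) : P ⊆ Q := by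
  induction h with
  | refl => exact subset_rfl
  | tail _ hm ih => exact ih.trans hm.1.subset

theorem reflTransGen_triFillMove_mono {P Q R : Set (ℤ × ℤ)}
    (h : Relation.ReflTransGen TriFillMove P Q) (hPR : P ⊆ R) :
    ∃ R', Relation.ReflTransGen TriFillMove R R' ∧ Q ⊆ R' := by
  induction h with
  | refl => exact ⟨R, .refl, hPR⟩
  | tail _ hm ih =>
    obtain ⟨R', hR', hsub⟩ := ih
    obtain ⟨_, v, hv, rfl⟩ := hm
    refine ⟨R' ∪ tr v TriShape, hR'.trans (reflTransGen_union_of_two_le ?_),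
      Set.union_subset_union_left _ hsub⟩
    rw [← hv]
    exact Set.ncard_le_ncard (Set.inter_subset_inter_left _ hsub)
      ((finite_tr_triShape v).inter_of_right _)

theorem subset_triFillClosure (P : Set (ℤ × ℤ)) : P ⊆ triFillClosure P :=
  fun _ hx => ⟨P, .refl, hx⟩

theorem tr_triShape_subset_triFillClosure {P : Set (ℤ × ℤ)} {v p q : ℤ × ℤ}
    (hp : p ∈ tr v TriShape) (hq : q ∈ tr v TriShape) (hpq : p ≠ q)
    (hpP : p ∈ triFillClosure P) (hqP : q ∈ triFillClosure P) :
    tr v TriShape ⊆ triFillClosure P := by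
  obtain ⟨Q₁, h₁, hp₁⟩ := hpP
  obtain ⟨Q₂, h₂, hq₂⟩ := hqP
  obtain ⟨R, hR, hQR⟩ :=
    reflTransGen_triFillMove_mono h₂ (subset_of_reflTransGen_triFillMove h₁)
  intro z hz
  refine ⟨_, (h₁.trans hR).trans (reflTransGen_union_of_two_le ?_), Or.inr hz⟩
  rw [← Set.ncard_pair hpq]
  refine Set.ncard_le_ncard ?_ ((finite_tr_triShape v).inter_of_right _)
  rintro w (rfl | rfl)
  exacts [⟨subset_of_reflTransGen_triFillMove hR hp₁, hp⟩, ⟨hQR hq₂, hq⟩]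

theorem fillClosed_triFillClosure (P : Set (ℤ × ℤ)) : FillClosed (triFillClosure P) := by
  intro x y
  have key := fun p q => tr_triShape_subset_triFillClosure (P := P) (v := (x, y)) (p := p) (q := q)
  simp only [tr_triShape] at key
  refine ⟨fun h₁ h₂ => key _ _ ?_ ?_ ?_ h₁ h₂ ?_, fun h₁ h₂ => key _ _ ?_ ?_ ?_ h₁ h₂ ?_,
    fun h₁ h₂ => key _ _ ?_ ?_ ?_ h₁ h₂ ?_⟩ <;> simp

theorem FillClosed.tr_triShape_subset {C : Set (ℤ × ℤ)} (hC : FillClosed C) {v : ℤ × ℤ}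
    (h : (C ∩ tr v TriShape).ncard = 2) : tr v TriShape ⊆ C := by
  obtain ⟨x, y⟩ := v
  obtain ⟨p, q, hpq, he⟩ := Set.ncard_eq_two.mp h
  have hp : p ∈ C ∩ tr (x, y) TriShape := he ▸ Set.mem_insert _ _
  have hq : q ∈ C ∩ tr (x, y) TriShape := he ▸ Set.mem_insert_of_mem _ rfl
  obtain ⟨h₁, h₂, h₃⟩ := hC x y
  rw [tr_triShape] at hp hq ⊢
  rintro z hz
  simp only [Set.mem_inter_iff, Set.mem_insert_iff, Set.mem_singleton_iff] at hp hq hz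
  grind

theorem FillClosed.triFillClosure_subset {P C : Set (ℤ × ℤ)} (hC : FillClosed C) (h : P ⊆ C) :
    triFillClosure P ⊆ C := by
  rintro x ⟨Q, hQ, hx⟩
  suffices Q ⊆ C from this hx
  clear hx
  induction hQ with
  | refl => exact h
  | tail _ hm ih =>
    obtain ⟨_, v, hv, rfl⟩ := hm
    refine Set.union_subset ih ?_
    by_cases hs : tr v TriShape ⊆ C
    · exact hs
    · refine hC.tr_triShape_subset (ncard_inter_tr_triShape_eq_two ?_ hs)
      rw [← hv]
      exact Set.ncard_le_ncard (Set.inter_subset_inter_left _ ih)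
        ((finite_tr_triShape v).inter_of_right _)

theorem mem_tr_TnSet {v p : ℤ × ℤ} {k : ℕ} :
    p ∈ tr v (TnSet k) ↔ v.1 ≤ p.1 ∧ v.2 ≤ p.2 ∧ p.1 + p.2 < v.1 + v.2 + k := by
  constructor
  · rintro ⟨q, ⟨h₁, h₂, h₃⟩, rfl⟩
    simp only [Prod.fst_add, Prod.snd_add]
    omega
  · rintro ⟨h₁, h₂, h₃⟩
    refine ⟨p - v, ⟨?_, ?_, ?_⟩, by simp⟩ <;> simp only [Prod.fst_sub, Prod.snd_sub] <;> omega

theorem Int.forall_mem_Icc_of_step {p : ℤ → Prop} {l u t : ℤ} (hlt : l ≤ t) (htu : t ≤ u)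
    (ht : p t) (step : ∀ b, l ≤ b → b < u → (p b ↔ p (b + 1))) (b : ℤ) (hlb : l ≤ b)
    (hbu : b ≤ u) : p b := by
  rcases le_total t b with h | h
  · induction b, h using Int.leInduction with
    | base => exact ht
    | succ b h ih => exact (step b (by omega) (by omega)).mp (ih (by omega) (by omega))
  · induction b, h using Int.leInductionDown with
    | base => exact ht
    | pred b h ih =>
      refine (step (b - 1) (by omega) (by omega)).mpr ?_
      rw [sub_add_cancel]
      exact ih (by omega) (by omega)

theorem FillClosed.mem_enclosing {C : Set (ℤ × ℤ)} (hC : FillClosed C) {x' y' s' : ℤ}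
    (hB : ∀ a b, x' ≤ a → y' ≤ b → a + b < s' → (a, b) ∈ C) (n : ℕ) :
    ∀ x y s : ℤ, (∀ a b, x ≤ a → y ≤ b → a + b < s → (a, b) ∈ C) →
      max x x' + max y y' ≤ min s s' →
      (x - min x x') + (y - min y y') + (max s s' - s) ≤ n →
      ∀ a b, min x x' ≤ a → min y y' ≤ b → a + b < max s s' → (a, b) ∈ C := by
  induction n with
  | zero =>
    intro x y s hA _ hn a b ha hb hab
    exact hA a b (by omega) (by omega) (by omega)
  | succ n ih =>
    intro x y s hA hD hn a b ha hb hab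
    by_cases hx : x' < x
    · refine ih (x - 1) y s ?_ (by omega) (by omega) a b (by omega) hb hab
      have line := Int.forall_mem_Icc_of_step (p := fun b => (x - 1, b) ∈ C) (l := y) (u := s - x)
        (t := max y y') (by omega) (by omega) (hB _ _ (by omega) (by omega) (by omega)) (by
          intro b _ _
          have hm := hA x b (by omega) (by omega) (by omega)
          have := hC (x - 1) b
          rw [sub_add_cancel] at this
          tauto)
      intro a b ha hb hab
      rcases eq_or_lt_of_le ha with rfl | ha
      · exact line b (by omega) (by omega)
      · exact hA a b (by omega) hb hab
    by_cases hy : y' < y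
    · refine ih x (y - 1) s ?_ (by omega) (by omega) a b ha (by omega) hab
      have line := Int.forall_mem_Icc_of_step (p := fun a => (a, y - 1) ∈ C) (l := x) (u := s - y)
        (t := max x x') (by omega) (by omega) (hB _ _ (by omega) (by omega) (by omega)) (by
          intro a _ _
          have hm := hA a y (by omega) (by omega) (by omega)
          have := hC a (y - 1)
          rw [sub_add_cancel] at this
          tauto)
      intro a b ha hb hab
      rcases eq_or_lt_of_le hb with rfl | hb
      · exact line a (by omega) (by omega)
      · exact hA a b ha (by omega) hab
    by_cases hs : s < s'
    · refine ih x y (s + 1) ?_ (by omega) (by omega) a b ha hb (by omega)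
      have line := Int.forall_mem_Icc_of_step (p := fun a => (a, s - a) ∈ C) (l := x) (u := s - y)
        (t := max x x') (by omega) (by omega) (hB _ _ (by omega) (by omega) (by omega)) (by
          intro a _ _
          have hm := hA a (s - (a + 1)) (by omega) (by omega) (by omega)
          have := hC a (s - (a + 1))
          rw [show s - (a + 1) + 1 = s - a by ring] at this
          tauto)
      intro a b ha hb hab
      rcases (show a + b < s ∨ b = s - a by omega) with h | rfl
      · exact hA a b ha hb h
      · exact line a (by omega) (by omega)
    · exact hA a b (by omega) (by omega) (by omega)

/-- The triangles `a.1 + T_{a.2}` and `b.1 + T_{b.2}` overlap or are adjacent. -/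
def TriTouch (a b : (ℤ × ℤ) × ℕ) : Prop :=
  max a.1.1 b.1.1 + max a.1.2 b.1.2 ≤ min (a.1.1 + a.1.2 + a.2) (b.1.1 + b.1.2 + b.2)

theorem TriTouch.symm {a b : (ℤ × ℤ) × ℕ} (h : TriTouch a b) : TriTouch b a := by
  unfold TriTouch at *
  omega

theorem triTouch_of_near {a b : (ℤ × ℤ) × ℕ} {p q : ℤ × ℤ} (hp : p ∈ tr a.1 (TnSet a.2))
    (hq : q ∈ tr b.1 (TnSet b.2)) (h : q = p ∨ q ∈ nbhd p) : TriTouch a b := by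
  rw [mem_tr_TnSet] at hp hq
  simp only [nbhd, Set.mem_insert_iff, Set.mem_singleton_iff, Prod.ext_iff, Prod.fst_add,
    Prod.snd_add] at h
  unfold TriTouch
  omega

/-- The union of the triangles `a.1 + T_{a.2}` over the entries `a` of a list. -/
def triUnion (L : List ((ℤ × ℤ) × ℕ)) : Set (ℤ × ℤ) := {p | ∃ a ∈ L, p ∈ tr a.1 (TnSet a.2)}

theorem triUnion_cons (a : (ℤ × ℤ) × ℕ) (L : List ((ℤ × ℤ) × ℕ)) :
    triUnion (a :: L) = tr a.1 (TnSet a.2) ∪ triUnion L := by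
  ext p
  simp [triUnion]

theorem triUnion_perm {L L' : List ((ℤ × ℤ) × ℕ)} (h : L.Perm L') : triUnion L = triUnion L' := by
  ext p
  simp [triUnion, h.mem_iff]

theorem TriTouch.exists_enclosing {a b : (ℤ × ℤ) × ℕ} (h : TriTouch a b) :
    ∃ c : (ℤ × ℤ) × ℕ, a.2 ≤ c.2 ∧ c.2 ≤ a.2 + b.2 ∧
      ∀ C, FillClosed C →
        (tr c.1 (TnSet c.2) ⊆ C ↔ tr a.1 (TnSet a.2) ⊆ C ∧ tr b.1 (TnSet b.2) ⊆ C) := by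
  obtain ⟨⟨x, y⟩, k⟩ := a
  obtain ⟨⟨x', y'⟩, k'⟩ := b
  simp only [TriTouch] at h
  refine ⟨((min x x', min y y'), (max (x + y + k) (x' + y' + k') - min x x' - min y y').toNat),
    by simp only; omega, by simp only; omega, fun C hC => ⟨fun hc => ⟨?_, ?_⟩, fun ⟨ha, hb⟩ => ?_⟩⟩
  · refine subset_trans (fun p hp => ?_) hc
    rw [mem_tr_TnSet] at hp ⊢
    simp only at hp ⊢
    omega
  · refine subset_trans (fun p hp => ?_) hc
    rw [mem_tr_TnSet] at hp ⊢
    simp only at hp ⊢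
    omega
  · rintro ⟨p, q⟩ hp
    rw [mem_tr_TnSet] at hp
    simp only at hp
    exact hC.mem_enclosing (x' := x') (y' := y') (s' := x' + y' + k')
      (fun a b h₁ h₂ h₃ => hb (mem_tr_TnSet.mpr ⟨h₁, h₂, h₃⟩)) _ x y (x + y + k)
      (fun a b h₁ h₂ h₃ => ha (mem_tr_TnSet.mpr ⟨h₁, h₂, h₃⟩)) h
      (Int.self_le_toNat _) p q
      (by omega) (by omega) (by omega)

theorem exists_separated_insert (n : ℕ) : ∀ (L : List ((ℤ × ℤ) × ℕ)) (a : (ℤ × ℤ) × ℕ),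
    L.length = n → L.Pairwise (fun b c => ¬ TriTouch b c) → (∀ b ∈ L, 1 ≤ b.2) → 1 ≤ a.2 →
    ∃ L' : List ((ℤ × ℤ) × ℕ), L'.Pairwise (fun b c => ¬ TriTouch b c) ∧ (∀ b ∈ L', 1 ≤ b.2) ∧
      (L'.map Prod.snd).sum ≤ a.2 + (L.map Prod.snd).sum ∧
      ∀ C, FillClosed C → (triUnion L' ⊆ C ↔ tr a.1 (TnSet a.2) ⊆ C ∧ triUnion L ⊆ C) := by
  induction n with
  | zero =>
    intro L a hL _ _ ha
    obtain rfl := List.length_eq_zero_iff.mp hL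
    exact ⟨[a], by simp, by simpa, by simp, fun C _ => by rw [triUnion_cons, Set.union_subset_iff]⟩
  | succ n ih =>
    intro L a hL hsep hpos ha
    by_cases ht : ∃ b ∈ L, TriTouch a b
    · obtain ⟨b, hb, hab⟩ := ht
      obtain ⟨c, hac, hc, hcC⟩ := hab.exists_enclosing
      have hperm := List.perm_cons_erase hb
      obtain ⟨L', h₁, h₂, h₃, h₄⟩ := ih (L.erase b) c (by simp [List.length_erase_of_mem hb, hL])
        (hsep.sublist List.erase_sublist) (fun d hd => hpos d (List.mem_of_mem_erase hd))
        (ha.trans hac)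
      refine ⟨L', h₁, h₂, ?_, fun C hC => ?_⟩
      · rw [(hperm.map Prod.snd).sum_eq, List.map_cons, List.sum_cons]
        omega
      · rw [h₄ C hC, hcC C hC, triUnion_perm hperm, triUnion_cons, Set.union_subset_iff, and_assoc]
    · push Not at ht
      refine ⟨a :: L, List.pairwise_cons.mpr ⟨ht, hsep⟩, ?_, by simp, fun C _ => by
        rw [triUnion_cons, Set.union_subset_iff]⟩
      simpa using ⟨ha, fun x y k => hpos ((x, y), k)⟩

theorem exists_separated_list (P : Finset (ℤ × ℤ)) :
    ∃ L : List ((ℤ × ℤ) × ℕ), L.Pairwise (fun b c => ¬ TriTouch b c) ∧ (∀ b ∈ L, 1 ≤ b.2) ∧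
      (L.map Prod.snd).sum ≤ P.card ∧
      ∀ C, FillClosed C → (triUnion L ⊆ C ↔ (P : Set (ℤ × ℤ)) ⊆ C) := by
  induction P using Finset.induction_on with
  | empty => exact ⟨[], by simp, by simp, by simp, by simp [triUnion]⟩
  | insert p P hp ih =>
    obtain ⟨L, h₁, h₂, h₃, h₄⟩ := ih
    obtain ⟨L', h₁', h₂', h₃', h₄'⟩ := exists_separated_insert _ L (p, 1) rfl h₁ h₂ le_rfl
    refine ⟨L', h₁', h₂', ?_, fun C hC => ?_⟩
    · rw [Finset.card_insert_of_notMem hp]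
      simp only at h₃'
      omega
    · have : tr p (TnSet 1) = {p} := by
        ext q
        rw [mem_tr_TnSet, Set.mem_singleton_iff, Prod.ext_iff]
        push_cast
        omega
      rw [h₄' C hC, h₄ C hC, this, Finset.coe_insert, Set.insert_subset_iff,
        Set.singleton_subset_iff]

theorem fillClosed_triUnion {L : List ((ℤ × ℤ) × ℕ)}
    (h : L.Pairwise (fun b c => ¬ TriTouch b c)) : FillClosed (triUnion L) := by
  have same : ∀ a ∈ L, ∀ b ∈ L, TriTouch a b → a = b := by
    intro a ha b hb hab
    by_contra hne
    have : Std.Symm fun b c => ¬ TriTouch b c := ⟨fun _ _ hn ht => hn ht.symm⟩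
    exact h.forall ha hb hne hab
  intro x y
  refine ⟨?_, ?_, ?_⟩ <;>
  · rintro ⟨a, ha, hpa⟩ ⟨b, hb, hqb⟩
    obtain rfl := same a ha b hb (triTouch_of_near hpa hqb (by simp [nbhd]))
    refine ⟨a, ha, ?_⟩
    rw [mem_tr_TnSet] at *
    simp only at *
    omega

/-- The filling closure of any finite pattern is a disjoint union of translated
triangles `v_i + T_{k_i}` whose neighborhoods are pairwise disjoint, with
`Σ k_i ≤ |P|`. -/
theorem triangle_fill_decomposition (P : Finset (ℤ × ℤ)) :
    ∃ (r : ℕ) (v : Fin r → ℤ × ℤ) (k : Fin r → ℕ),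
      (∀ i, 1 ≤ k i) ∧
      triFillClosure (P : Set (ℤ × ℤ)) = ⋃ i, tr (v i) (TnSet (k i)) ∧
      (∑ i, k i) ≤ P.card ∧
      (∀ i j, i ≠ j → Disjoint (tr (v i) (TnSet (k i))) (tr (v j) (TnSet (k j)))) ∧
      (∀ i j, i ≠ j →
        (⋃ p ∈ tr (v i) (TnSet (k i)), nbhd p) ∩ tr (v j) (TnSet (k j)) = ∅) := by
  obtain ⟨L, hsep, hpos, hsum, hC⟩ := exists_separated_list P
  have hnt : ∀ i j : Fin L.length, i ≠ j → ¬ TriTouch (L.get i) (L.get j) := by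
    intro i j hij
    rcases lt_or_gt_of_ne hij with h | h
    · exact List.pairwise_iff_get.mp hsep i j h
    · exact fun ht => List.pairwise_iff_get.mp hsep j i h ht.symm
  refine ⟨L.length, fun i => (L.get i).1, fun i => (L.get i).2,
    fun i => hpos _ (L.get_mem i), ?_, ?_, fun i j hij => ?_, fun i j hij => ?_⟩
  · have hU : triUnion L = ⋃ i, tr (L.get i).1 (TnSet (L.get i).2) := by
      ext p
      simp only [triUnion, Set.mem_ofPred_eq, Set.mem_iUnion, List.mem_iff_get]
      constructor
      · rintro ⟨_, ⟨i, rfl⟩, hp⟩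
        exact ⟨i, hp⟩
      · rintro ⟨i, hp⟩
        exact ⟨_, ⟨i, rfl⟩, hp⟩
    rw [← hU]
    have hcl := fillClosed_triUnion hsep
    exact (hcl.triFillClosure_subset ((hC _ hcl).mp subset_rfl)).antisymm
      ((hC _ (fillClosed_triFillClosure _)).mpr (subset_triFillClosure _))
  · refine le_of_eq_of_le ?_ hsum
    rw [← Fin.sum_univ_fun_getElem]
    rfl
  · rw [Set.disjoint_left]
    exact fun p hp hq => hnt i j hij (triTouch_of_near hp hq (Or.inl rfl))
  · rw [Set.eq_empty_iff_forall_notMem]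
    rintro q ⟨hq, hqj⟩
    obtain ⟨p, hp, hpq⟩ := Set.mem_iUnion₂.mp hq
    exact hnt i j hij (triTouch_of_near hp hqj (Or.inr hpq))
end
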